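/- arXiv:0810.5285 — 7 statements merged into one kernel-verified Lean document; each statement's English description precedes it below -/
import Mathlib

section
/- Let a, b ∈ (0,∞) and let f ∈ 𝓕 be a solution of the functional equation f(t) = f(at) + f(bt) for all t ≥ 0. Then a, b ∈ (0,1) and there exist p > 0 and a continuous function H : (0,∞) → ℝ \ {0} such that H(t) = H(at) = H(bt) for every t > 0 and f(t) = t^p · H(t) for every t > 0. Moreover, if ln a / ln b is irrational, then H is constant. -/
/-- `𝓕`: continuous functions `f : [0,∞) → ℝ` with `f 0 = 0` and `0` an isolated
point of the zero set `{x ≥ 0 : f x = 0}`. -/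
def MemClassF (f : ℝ → ℝ) : Prop :=
  ContinuousOn f (Set.Ici 0) ∧ f 0 = 0 ∧ ∃ u > (0:ℝ), ∀ x, 0 < x → x < u → f x ≠ 0

open Finset Filter Topology

/-- The `(i, j)`-th mixed moment of the binomial weights that arise from iterating
`g x = g (x + α) + g (x + β)` exactly `n` times. -/
noncomputable def binomMoment (g : ℝ → ℝ) (α β : ℝ) (i j n : ℕ) (x : ℝ) : ℝ :=
  ∑ p ∈ antidiagonal n,
    (n.choose p.1 : ℝ) * g (x + p.1 * α + p.2 * β) * (((p.1 : ℝ) / n) ^ i * ((p.2 : ℝ) / n) ^ j)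

lemma binomMoment_swap (g : ℝ → ℝ) (α β : ℝ) (i j n : ℕ) (x : ℝ) :
    binomMoment g α β i j n x = binomMoment g β α j i n x := by
  unfold binomMoment
  rw [← Finset.Nat.sum_antidiagonal_swap]
  refine sum_congr rfl fun p hp => ?_
  have h := mem_antidiagonal.1 hp
  have hc : n.choose p.2 = n.choose p.1 := (Nat.choose_symm_of_eq_add h.symm).symm
  simp only [Prod.fst_swap, Prod.snd_swap]
  rw [hc, add_right_comm x, mul_comm (((p.2 : ℝ) / n) ^ i)]

lemma binomMoment_zero_zero {g : ℝ → ℝ} {α β : ℝ} (hg : ∀ x, g x = g (x + α) + g (x + β))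
    (n : ℕ) (x : ℝ) : binomMoment g α β 0 0 n x = g x := by
  unfold binomMoment
  simp only [pow_zero, mul_one]
  induction n generalizing x with
  | zero => simp
  | succ n ih =>
    rw [sum_antidiagonal_choose_succ_mul fun k l => g (x + k * α + l * β), hg x, add_comm,
      ← ih (x + α), ← ih (x + β)]
    congr 1
    · refine sum_congr rfl fun p hp => ?_
      rw [Nat.choose_symm_of_eq_add (mem_antidiagonal.1 hp).symm]
      push_cast
      ring_nf
    · refine sum_congr rfl fun p _ => ?_
      push_cast
      ring_nf

lemma abs_pow_mul_pow_sub_le {s t s' t' ε : ℝ} (hs : s ∈ Set.Icc (0 : ℝ) 1)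
    (ht : t ∈ Set.Icc (0 : ℝ) 1) (hs' : s' ∈ Set.Icc (0 : ℝ) 1) (ht' : t' ∈ Set.Icc (0 : ℝ) 1)
    (hss : |s - s'| ≤ ε) (htt : |t - t'| ≤ ε) (i j : ℕ) :
    |s ^ i * t ^ j - s' ^ i * t' ^ j| ≤ (i + j) * ε := by
  have key : ∀ {u v : ℝ}, u ∈ Set.Icc (0 : ℝ) 1 → v ∈ Set.Icc (0 : ℝ) 1 → |u - v| ≤ ε →
      ∀ k : ℕ, |u ^ k - v ^ k| ≤ k * ε := by
    intro u v hu hv huv k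
    refine (abs_pow_sub_pow_le u v k).trans ?_
    rw [abs_of_nonneg hu.1, abs_of_nonneg hv.1]
    have h1 : max u v ^ (k - 1) ≤ 1 :=
      pow_le_one₀ (le_max_of_le_left hu.1) (max_le hu.2 hv.2)
    calc |u - v| * k * max u v ^ (k - 1) ≤ |u - v| * k * 1 := by gcongr
      _ = k * |u - v| := by ring
      _ ≤ k * ε := by gcongr
  have hε : 0 ≤ ε := (abs_nonneg _).trans hss
  calc |s ^ i * t ^ j - s' ^ i * t' ^ j|
      = |(s ^ i - s' ^ i) * t ^ j + s' ^ i * (t ^ j - t' ^ j)| := by ring_nf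
    _ ≤ |s ^ i - s' ^ i| * t ^ j + s' ^ i * |t ^ j - t' ^ j| := by
      refine (abs_add_le _ _).trans_eq ?_
      rw [abs_mul, abs_mul, abs_of_nonneg (pow_nonneg ht.1 j), abs_of_nonneg (pow_nonneg hs'.1 i)]
    _ ≤ i * ε * 1 + 1 * (j * ε) := by
      gcongr
      · exact pow_nonneg ht.1 j
      · exact key hs hs' hss i
      · exact pow_le_one₀ ht.1 ht.2
      · exact pow_le_one₀ hs'.1 hs'.2
      · exact key ht ht' htt j
    _ = (i + j) * ε := by ring

lemma abs_binomMoment_succ_sub_le {g : ℝ → ℝ} {α β : ℝ} (hpos : ∀ x, 0 < g x)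
    (hg : ∀ x, g x = g (x + α) + g (x + β)) (i j : ℕ) {n : ℕ} (hn : 0 < n) (x : ℝ) :
    |binomMoment g α β (i + 1) j (n + 1) x - binomMoment g α β i j n (x + α)| ≤
      (i + j) * (1 / (n + 1)) * g (x + α) := by
  have hn' : (0 : ℝ) < n := by exact_mod_cast hn
  have hsucc : binomMoment g α β (i + 1) j (n + 1) x = ∑ p ∈ antidiagonal n,
      (n.choose p.1 : ℝ) * g (x + α + p.1 * α + p.2 * β) *
        ((((p.1 : ℝ) + 1) / (n + 1)) ^ i * ((p.2 : ℝ) / (n + 1)) ^ j) := by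
    unfold binomMoment
    rw [Finset.Nat.sum_antidiagonal_succ]
    simp only [Nat.cast_zero, zero_div, pow_succ, mul_zero, zero_mul, zero_add]
    refine sum_congr rfl fun p _ => ?_
    have hc : ((n : ℝ) + 1) * n.choose p.1 = (n + 1).choose (p.1 + 1) * (p.1 + 1) := by
      exact_mod_cast Nat.add_one_mul_choose_eq n p.1
    have hc' : (n.choose p.1 : ℝ) = (n + 1).choose (p.1 + 1) * ((p.1 + 1) / (n + 1)) := by
      field_simp
      linarith
    rw [hc']
    push_cast
    ring_nf
  rw [hsucc, ← binomMoment_zero_zero hg n (x + α)]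
  unfold binomMoment
  rw [← sum_sub_distrib, mul_sum]
  refine (abs_sum_le_sum_abs _ _).trans (sum_le_sum fun p hp => ?_)
  have hp' : (p.1 : ℝ) + p.2 = n := by exact_mod_cast mem_antidiagonal.1 hp
  have h1 : (0 : ℝ) ≤ p.1 := Nat.cast_nonneg _
  have h2 : (0 : ℝ) ≤ p.2 := Nat.cast_nonneg _
  rw [← mul_sub, abs_mul, abs_of_nonneg (mul_nonneg (Nat.cast_nonneg _) (hpos _).le)]
  simp only [pow_zero, mul_one]
  rw [mul_comm ((i + j : ℝ) * _)]
  refine mul_le_mul_of_nonneg_left ?_ (mul_nonneg (Nat.cast_nonneg _) (hpos _).le)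
  apply abs_pow_mul_pow_sub_le
  · exact ⟨by positivity, by rw [div_le_one (by positivity)]; linarith⟩
  · exact ⟨by positivity, by rw [div_le_one (by positivity)]; linarith⟩
  · exact ⟨by positivity, by rw [div_le_one (by positivity)]; linarith⟩
  · exact ⟨by positivity, by rw [div_le_one (by positivity)]; linarith⟩
  · have : ((p.1 : ℝ) + 1) / (n + 1) - p.1 / n = (p.2 / n) * (1 / (n + 1)) := by
      rw [← hp'] at hn' ⊢
      field_simp
      ring
    rw [this, abs_of_nonneg (by positivity)]
    refine mul_le_of_le_one_left (by positivity) ?_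
    rw [div_le_one (by positivity)]; linarith
  · have : (p.2 : ℝ) / (n + 1) - p.2 / n = -((p.2 / n) * (1 / (n + 1))) := by
      field_simp
      ring
    rw [this, abs_neg, abs_of_nonneg (by positivity)]
    refine mul_le_of_le_one_left (by positivity) ?_
    rw [div_le_one (by positivity)]; linarith

lemma tendsto_binomMoment_succ {g : ℝ → ℝ} {α β : ℝ} (hpos : ∀ x, 0 < g x)
    (hg : ∀ x, g x = g (x + α) + g (x + β)) {i j : ℕ} {x L : ℝ}
    (h : Tendsto (fun n => binomMoment g α β i j n (x + α)) atTop (𝓝 L)) :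
    Tendsto (fun n => binomMoment g α β (i + 1) j n x) atTop (𝓝 L) := by
  rw [← tendsto_add_atTop_iff_nat 1]
  have hz : Tendsto (fun n : ℕ => ((i : ℝ) + j) * (1 / ((n : ℝ) + 1)) * g (x + α))
      atTop (𝓝 0) := by
    simpa using (tendsto_one_div_add_atTop_nhds_zero_nat.const_mul ((i : ℝ) + j)).mul_const
      (g (x + α))
  have hd : Tendsto (fun n => binomMoment g α β (i + 1) j (n + 1) x -
      binomMoment g α β i j n (x + α)) atTop (𝓝 0) := by
    refine squeeze_zero_norm' ?_ hz
    filter_upwards [eventually_gt_atTop 0] with n hn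
    exact abs_binomMoment_succ_sub_le hpos hg i j hn x
  simpa using hd.add h

lemma tendsto_binomMoment {g : ℝ → ℝ} {α β : ℝ} (hpos : ∀ x, 0 < g x)
    (hg : ∀ x, g x = g (x + α) + g (x + β)) (i j : ℕ) (x : ℝ) :
    Tendsto (fun n => binomMoment g α β i j n x) atTop (𝓝 (g (x + i * α + j * β))) := by
  induction i generalizing x with
  | zero =>
    simp_rw [binomMoment_swap g α β]
    induction j generalizing x with
    | zero =>
      have hg' : ∀ x, g x = g (x + β) + g (x + α) := fun x => by rw [add_comm, ← hg]
      simp [binomMoment_zero_zero hg']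
    | succ j ih =>
      have hg' : ∀ x, g x = g (x + β) + g (x + α) := fun x => by rw [add_comm, ← hg]
      convert tendsto_binomMoment_succ hpos hg' (ih (x + β)) using 3
      push_cast
      ring
  | succ i ih =>
    convert tendsto_binomMoment_succ hpos hg (ih (x + α)) using 3
    push_cast
    ring

lemma sq_le_mul_of_moments {g : ℝ → ℝ} {α β : ℝ} (hpos : ∀ x, 0 < g x)
    (hg : ∀ x, g x = g (x + α) + g (x + β)) (i j k l : ℕ) (x : ℝ) :
    g (x + ((i + k : ℕ) : ℝ) * α + ((j + l : ℕ) : ℝ) * β) ^ 2 ≤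
      g (x + ((2 * i : ℕ) : ℝ) * α + ((2 * j : ℕ) : ℝ) * β) *
        g (x + ((2 * k : ℕ) : ℝ) * α + ((2 * l : ℕ) : ℝ) * β) := by
  refine le_of_tendsto_of_tendsto' ((tendsto_binomMoment hpos hg _ _ x).pow 2)
    ((tendsto_binomMoment hpos hg _ _ x).mul (tendsto_binomMoment hpos hg _ _ x)) fun n => ?_
  refine sum_sq_le_sum_mul_sum_of_sq_le_mul _ (fun p _ => ?_) (fun p _ => ?_) fun p _ => ?_
  · have := (hpos (x + p.1 * α + p.2 * β)).le
    positivity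
  · have := (hpos (x + p.1 * α + p.2 * β)).le
    positivity
  · apply le_of_eq
    ring

/-- Log-convexity along every direction of the group generated by `α` and `β`. -/
lemma sq_le_mul_of_mem_closure {g : ℝ → ℝ} {α β : ℝ} (hpos : ∀ x, 0 < g x)
    (hg : ∀ x, g x = g (x + α) + g (x + β)) {d : ℝ} (hd : d ∈ AddSubgroup.closure {α, β})
    (x : ℝ) : g x ^ 2 ≤ g (x + d) * g (x - d) := by
  obtain ⟨m, n, rfl⟩ := AddSubgroup.mem_closure_pair.1 hd
  have key : ∀ i j k l : ℕ, g x ^ 2 ≤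
      g (x + (((i : ℝ) - k) * α + ((j : ℝ) - l) * β)) *
        g (x - (((i : ℝ) - k) * α + ((j : ℝ) - l) * β)) := by
    intro i j k l
    convert sq_le_mul_of_moments hpos hg i j k l
      (x - ((i : ℝ) + k) * α - ((j : ℝ) + l) * β) using 3 <;> push_cast <;> ring_nf
  have hm : (m : ℝ) = (m.toNat : ℝ) - ((-m).toNat : ℝ) := by
    exact_mod_cast (Int.toNat_sub_toNat_neg m).symm
  have hn : (n : ℝ) = (n.toNat : ℝ) - ((-n).toNat : ℝ) := by
    exact_mod_cast (Int.toNat_sub_toNat_neg n).symm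
  simp only [zsmul_eq_mul]
  rw [hm, hn]
  exact key _ _ _ _

lemma isCompact_coset_inter_Icc {T : AddSubgroup ℝ} (hT : IsClosed (T : Set ℝ)) (w z : ℝ) :
    IsCompact {t | t ∈ Set.Icc w z ∧ t - w ∈ T} :=
  isCompact_Icc.inter_right (hT.preimage (continuous_id.sub continuous_const))

/-- A positive continuous function that is log-convex along a closed subgroup is quasi-convex
on its cosets. -/
lemma le_max_of_log_convex {h : ℝ → ℝ} {T : AddSubgroup ℝ} (hT : IsClosed (T : Set ℝ))
    (hc : Continuous h) (hpos : ∀ x, 0 < h x)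
    (hlog : ∀ d ∈ T, ∀ x, h x ^ 2 ≤ h (x + d) * h (x - d)) {w t z : ℝ}
    (hwt : w ≤ t) (htz : t ≤ z) (ht : t - w ∈ T) (hz : z - w ∈ T) :
    h t ≤ max (h w) (h z) := by
  obtain ⟨m, ⟨⟨hwm, hmz⟩, hmT⟩, hmax⟩ := (isCompact_coset_inter_Icc hT w z).exists_isMaxOn
    ⟨t, ⟨hwt, htz⟩, ht⟩ hc.continuousOn
  have hmax' : ∀ s, w ≤ s → s ≤ z → s - w ∈ T → h s ≤ h m := fun s h1 h2 h3 =>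
    hmax ⟨⟨h1, h2⟩, h3⟩
  refine (hmax' t hwt htz ht).trans ?_
  by_contra! hlt
  obtain ⟨h1, h2⟩ := max_lt_iff.1 hlt
  have hzm : z - m ∈ T := by simpa using T.sub_mem hz hmT
  rcases le_total (m - w) (z - m) with hle | hle
  · have e := hlog _ hmT m
    have e1 : h (m + (m - w)) ≤ h m := hmax' _ (by linarith) (by linarith) (by
      have := T.add_mem hmT hmT
      convert this using 1; ring)
    rw [show m - (m - w) = w by ring] at e
    nlinarith [hpos w, hpos m, hpos (m + (m - w))]
  · have e := hlog _ hzm m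
    have e1 : h (m - (z - m)) ≤ h m := hmax' _ (by linarith) (by linarith) (by
      have := T.sub_mem hmT hzm
      convert this using 1; ring)
    rw [show m + (z - m) = z by ring] at e
    nlinarith [hpos z, hpos m, hpos (m - (z - m))]

lemma add_le_of_harmonic {h : ℝ → ℝ} {T : AddSubgroup ℝ} (hT : IsClosed (T : Set ℝ))
    (hc : Continuous h) (hpos : ∀ x, 0 < h x)
    (hlog : ∀ d ∈ T, ∀ x, h x ^ 2 ≤ h (x + d) * h (x - d)) {α β q r : ℝ}
    (hα : 0 < α) (hβ : 0 < β) (hαT : α ∈ T) (hβT : β ∈ T) (hq : 0 < q) (hr : 0 < r)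
    (hqr : q + r = 1) (hh : ∀ x, h x = q * h (x + α) + r * h (x + β)) (y : ℝ) :
    h (y + α) ≤ h y := by
  by_contra! hlt
  obtain ⟨m, ⟨⟨hym, hmz⟩, hmT⟩, hmin⟩ :=
    (isCompact_coset_inter_Icc hT y (y + α + β)).exists_isMinOn
      ⟨y, ⟨le_rfl, by linarith⟩, by simp⟩ hc.continuousOn
  have hmin' : ∀ s, y ≤ s → s ≤ y + α + β → s - y ∈ T → h m ≤ h s := fun s h1 h2 h3 =>
    hmin ⟨⟨h1, h2⟩, h3⟩
  have hmy : h m ≤ h y := hmin' y le_rfl (by linarith) (by simp)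
  have hbig : ∀ z, y + α ≤ z → z - y ∈ T → h y < h z := fun z hz hzT => by
    have := le_max_of_log_convex hT hc hpos hlog (w := y) (by linarith) hz (by simpa) hzT
    rcases le_max_iff.1 this with h1 | h1 <;> linarith
  have hmα : m < y + α := by
    by_contra! hge
    linarith [hbig m hge hmT]
  have h1 : h m < h (m + α) := hmy.trans_lt (hbig _ (by linarith) (by
    have := T.add_mem hmT hαT
    convert this using 1; ring))
  have h2 : h m ≤ h (m + β) := hmin' _ (by linarith) (by linarith) (by
    have := T.add_mem hmT hβT
    convert this using 1; ring)
  have h3 := hh m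
  have h4 : r = 1 - q := by linarith
  subst h4
  nlinarith

/-- Positive continuous solutions of `g x = g (x + α) + g (x + β)` are, up to an exponential
factor, periodic with periods `α` and `β`. -/
lemma add_eq_exp_mul {g : ℝ → ℝ} (hc : Continuous g) (hpos : ∀ x, 0 < g x) {α β p : ℝ}
    (hα : 0 < α) (hβ : 0 < β) (hg : ∀ x, g x = g (x + α) + g (x + β))
    (hp : Real.exp (-(p * α)) + Real.exp (-(p * β)) = 1) (x : ℝ) :
    g (x + α) = Real.exp (-(p * α)) * g x ∧ g (x + β) = Real.exp (-(p * β)) * g x := by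
  set h : ℝ → ℝ := fun x => Real.exp (p * x) * g x with hdef
  have hcont : Continuous h := by fun_prop
  have hhpos : ∀ x, 0 < h x := fun x => mul_pos (Real.exp_pos _) (hpos x)
  set T := (AddSubgroup.closure {α, β}).topologicalClosure
  have hT : IsClosed (T : Set ℝ) := AddSubgroup.isClosed_topologicalClosure _
  have hsub : AddSubgroup.closure {α, β} ≤ T := AddSubgroup.le_topologicalClosure _
  have hαT : α ∈ T := hsub (AddSubgroup.subset_closure (by simp))
  have hβT : β ∈ T := hsub (AddSubgroup.subset_closure (by simp))
  have hlogg : ∀ d ∈ T, ∀ x, g x ^ 2 ≤ g (x + d) * g (x - d) := by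
    intro d hd x
    have hcl : IsClosed {d | g x ^ 2 ≤ g (x + d) * g (x - d)} :=
      isClosed_le continuous_const (by fun_prop)
    exact closure_minimal (fun d hd => sq_le_mul_of_mem_closure hpos hg hd x) hcl hd
  have hlog : ∀ d ∈ T, ∀ x, h x ^ 2 ≤ h (x + d) * h (x - d) := by
    intro d hd x
    have e : Real.exp (p * (x + d)) * Real.exp (p * (x - d)) = Real.exp (p * x) ^ 2 := by
      rw [← Real.exp_add, ← Real.exp_nat_mul]
      congr 1
      push_cast
      ring
    calc h x ^ 2 = Real.exp (p * x) ^ 2 * g x ^ 2 := by simp only [hdef]; ring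
      _ ≤ Real.exp (p * x) ^ 2 * (g (x + d) * g (x - d)) := by
        gcongr
        exact hlogg d hd x
      _ = h (x + d) * h (x - d) := by rw [← e]; simp only [hdef]; ring
  have hexp : ∀ x c, Real.exp (-(p * c)) * h (x + c) = Real.exp (p * x) * g (x + c) := by
    intro x c
    simp only [hdef]
    rw [← mul_assoc, ← Real.exp_add]
    ring_nf
  have hh : ∀ x, h x = Real.exp (-(p * α)) * h (x + α) + Real.exp (-(p * β)) * h (x + β) := by
    intro x
    rw [hexp, hexp, ← mul_add, ← hg]
  have h1 := add_le_of_harmonic hT hcont hhpos hlog hα hβ hαT hβT (Real.exp_pos _)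
    (Real.exp_pos _) hp hh x
  have h2 := add_le_of_harmonic hT hcont hhpos hlog hβ hα hβT hαT (Real.exp_pos _)
    (Real.exp_pos _) ((add_comm _ _).trans hp) (fun x => (hh x).trans (add_comm _ _)) x
  have hx := hh x
  have hA : h (x + α) = h x := by
    refine le_antisymm h1 (le_of_mul_le_mul_left ?_ (Real.exp_pos (-(p * α))))
    have := mul_le_mul_of_nonneg_left h2 (Real.exp_pos (-(p * β))).le
    linear_combination this + hx + h x * hp
  have hB : h (x + β) = h x := by
    refine le_antisymm h2 (le_of_mul_le_mul_left ?_ (Real.exp_pos (-(p * β))))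
    have := mul_le_mul_of_nonneg_left h1 (Real.exp_pos (-(p * α))).le
    linear_combination this + hx + h x * hp
  have fin : ∀ c, h (x + c) = h x → g (x + c) = Real.exp (-(p * c)) * g x := by
    intro c hcx
    have e := hexp x c
    rw [hcx] at e
    refine mul_left_cancel₀ (Real.exp_pos (p * x)).ne' ?_
    rw [← e]
    simp only [hdef]
    ring
  exact ⟨fin α hA, fin β hB⟩

lemma lt_one_of_le {a b u : ℝ} (ha : 0 < a) (hb : 0 < b) (hba : b ≤ a) {f : ℝ → ℝ}
    (hc : ContinuousOn f (Set.Ici 0)) (h0 : f 0 = 0) (hu : 0 < u)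
    (hpos : ∀ x, 0 < x → x < u → 0 < f x)
    (heq : ∀ t : ℝ, 0 ≤ t → f t = f (a * t) + f (b * t)) : a < 1 := by
  by_contra! h1
  have step : ∀ s, 0 < s → s < u → f s < f (s / a) := by
    intro s hs hsu
    have e := heq (s / a) (by positivity)
    rw [mul_div_cancel₀ s ha.ne'] at e
    have hle : b * (s / a) ≤ s := by
      rw [← mul_div_assoc, div_le_iff₀ ha]
      nlinarith
    linarith [hpos (b * (s / a)) (by positivity) (hle.trans_lt hsu)]
  rcases h1.eq_or_lt with rfl | h1
  · have := step (u / 2) (by positivity) (by linarith)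
    simp at this
  have hs : ∀ n : ℕ, f (u / 2) ≤ f (u / 2 / a ^ n) := by
    intro n
    induction n with
    | zero => simp
    | succ n ih =>
      have hlt : u / 2 / a ^ n < u :=
        (div_le_self (by positivity) (one_le_pow₀ h1.le)).trans_lt (by linarith)
      have := step (u / 2 / a ^ n) (by positivity) hlt
      rw [div_div (u / 2), ← pow_succ] at this
      linarith
  have ht : Tendsto (fun n : ℕ => u / 2 / a ^ n) atTop (𝓝[Set.Ici 0] 0) := by
    refine tendsto_nhdsWithin_iff.2 ⟨?_, Eventually.of_forall fun n => ?_⟩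
    · exact (tendsto_pow_atTop_atTop_of_one_lt h1).const_div_atTop _
    · exact Set.mem_Ici.2 (by positivity)
  have hf : Tendsto (fun n : ℕ => f (u / 2 / a ^ n)) atTop (𝓝 (f 0)) :=
    (hc 0 Set.self_mem_Ici).tendsto.comp ht
  have := ge_of_tendsto' hf hs
  linarith [hpos (u / 2) (by positivity) (by linarith)]

lemma exists_rpow_add_rpow_eq_one {a b : ℝ} (ha : 0 < a) (hb : 0 < b) (ha1 : a < 1)
    (hb1 : b < 1) : ∃ p : ℝ, 0 < p ∧ a ^ p + b ^ p = 1 := by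
  have ht : Tendsto (fun p : ℝ => a ^ p + b ^ p) atTop (𝓝 0) := by
    simpa using (tendsto_rpow_atTop_of_base_lt_one a (by linarith) ha1).add
      (tendsto_rpow_atTop_of_base_lt_one b (by linarith) hb1)
  obtain ⟨P, hP, hP0⟩ :=
    ((ht.eventually (gt_mem_nhds one_pos)).and (eventually_gt_atTop 0)).exists
  have hcont : Continuous fun p : ℝ => a ^ p + b ^ p :=
    (Real.continuous_const_rpow ha.ne').add (Real.continuous_const_rpow hb.ne')
  obtain ⟨p, ⟨hp, -⟩, hpe⟩ := intermediate_value_Icc' hP0.le hcont.continuousOn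
    ⟨hP.le, by norm_num⟩
  refine ⟨p, hp.lt_of_ne ?_, hpe⟩
  rintro rfl
  norm_num at hpe

lemma pos_of_pos_near_zero {a b u : ℝ} (ha : 0 < a) (hb : 0 < b) (ha1 : a < 1) (hb1 : b < 1)
    {f : ℝ → ℝ} (hu : 0 < u) (hpos : ∀ x, 0 < x → x < u → 0 < f x)
    (heq : ∀ t : ℝ, 0 ≤ t → f t = f (a * t) + f (b * t)) {t : ℝ} (ht : 0 < t) : 0 < f t := by
  have key : ∀ n : ℕ, ∀ t, 0 < t → max a b ^ n * t < u → 0 < f t := by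
    intro n
    induction n with
    | zero => exact fun t ht h => hpos t ht (by simpa using h)
    | succ n ih =>
      intro t ht h
      have hm : 0 < max a b := lt_max_of_lt_left ha
      rw [pow_succ, mul_assoc] at h
      rw [heq t ht.le]
      refine add_pos (ih _ (by positivity) (h.trans_le' ?_)) (ih _ (by positivity) (h.trans_le' ?_))
      · gcongr
        exact le_max_left _ _
      · gcongr
        exact le_max_right _ _
  obtain ⟨n, hn⟩ := exists_pow_lt_of_lt_one (div_pos hu ht) (max_lt ha1 hb1)
  exact key n t ht ((lt_div_iff₀ ht).1 hn)

lemma scaling_of_pos_near_zero {a b u : ℝ} (ha : 0 < a) (hb : 0 < b) {f : ℝ → ℝ}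
    (hc : ContinuousOn f (Set.Ici 0)) (h0 : f 0 = 0) (hu : 0 < u)
    (hpos : ∀ x, 0 < x → x < u → 0 < f x)
    (heq : ∀ t : ℝ, 0 ≤ t → f t = f (a * t) + f (b * t)) :
    a < 1 ∧ b < 1 ∧ ∃ p : ℝ, 0 < p ∧
      ∀ t, 0 < t → f t ≠ 0 ∧ f (a * t) = a ^ p * f t ∧ f (b * t) = b ^ p * f t := by
  obtain ⟨ha1, hb1⟩ : a < 1 ∧ b < 1 := by
    rcases le_total b a with h | h
    · have := lt_one_of_le ha hb h hc h0 hu hpos heq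
      exact ⟨this, h.trans_lt this⟩
    · have := lt_one_of_le hb ha h hc h0 hu hpos fun t ht => (heq t ht).trans (add_comm _ _)
      exact ⟨h.trans_lt this, this⟩
  obtain ⟨p, hp, hpe⟩ := exists_rpow_add_rpow_eq_one ha hb ha1 hb1
  have hfpos : ∀ t, 0 < t → 0 < f t := fun t ht =>
    pos_of_pos_near_zero ha hb ha1 hb1 hu hpos heq ht
  refine ⟨ha1, hb1, p, hp, fun t ht => ⟨(hfpos t ht).ne', ?_⟩⟩
  have hexp : ∀ c, 0 < c → Real.exp (-(p * -Real.log c)) = c ^ p := fun c hc => by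
    rw [Real.rpow_def_of_pos hc]
    ring_nf
  have hmul : ∀ c, 0 < c → ∀ x, Real.exp (-(x + -Real.log c)) = c * Real.exp (-x) := by
    intro c hc x
    rw [neg_add, neg_neg, Real.exp_add, Real.exp_log hc, mul_comm]
  have hgc : Continuous fun x => f (Real.exp (-x)) :=
    hc.comp_continuous (by fun_prop) fun x => (Real.exp_pos _).le
  have := add_eq_exp_mul (g := fun x => f (Real.exp (-x))) (α := -Real.log a)
    (β := -Real.log b) (p := p) hgc (fun x => hfpos _ (Real.exp_pos _))
    (neg_pos.2 (Real.log_neg ha ha1)) (neg_pos.2 (Real.log_neg hb hb1))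
    (fun x => by
      simp only [hmul a ha, hmul b hb]
      exact heq _ (Real.exp_pos _).le)
    (by rw [hexp a ha, hexp b hb, hpe]) (-Real.log t)
  simp only [hmul a ha, hmul b hb, hexp a ha, hexp b hb, neg_neg, Real.exp_log ht] at this
  exact this

lemma eq_of_dense_periods {K : ℝ → ℝ} (hK : Continuous K) {c d : ℝ} (hcd : Irrational (c / d))
    (hc : ∀ x, K (x + c) = K x) (hd : ∀ x, K (x + d) = K x) (x y : ℝ) : K x = K y := by
  have hper : ∀ e ∈ AddSubgroup.closure {c, d}, ∀ x, K (x + e) = K x := by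
    intro e he
    obtain ⟨m, n, rfl⟩ := AddSubgroup.mem_closure_pair.1 he
    have h1 : Function.Periodic K c := hc
    have h2 : Function.Periodic K d := hd
    exact (h1.zsmul m).add_period (h2.zsmul n)
  have hdense := dense_addSubgroupClosure_pair_iff.2 hcd
  have hext : (fun e => K (x + e)) = fun _ => K x :=
    Continuous.ext_on hdense (by fun_prop) continuous_const fun e he => hper e he x
  simpa using (congrFun hext (y - x)).symm

theorem stmt_0 (a b : ℝ) (ha : 0 < a) (hb : 0 < b) (f : ℝ → ℝ)
    (hf : MemClassF f) (heq : ∀ t : ℝ, 0 ≤ t → f t = f (a * t) + f (b * t)) :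
    a < 1 ∧ b < 1 ∧
    ∃ p : ℝ, 0 < p ∧ ∃ H : ℝ → ℝ,
      ContinuousOn H (Set.Ioi 0) ∧
      (∀ t : ℝ, 0 < t → H t ≠ 0) ∧
      (∀ t : ℝ, 0 < t → H t = H (a * t) ∧ H t = H (b * t)) ∧
      (∀ t : ℝ, 0 < t → f t = t ^ p * H t) ∧
      (Irrational (Real.log a / Real.log b) →
        ∀ s t : ℝ, 0 < s → 0 < t → H s = H t) := by
  obtain ⟨hc, h0, u, hu, hne⟩ := hf
  have hscale : a < 1 ∧ b < 1 ∧ ∃ p : ℝ, 0 < p ∧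
      ∀ t, 0 < t → f t ≠ 0 ∧ f (a * t) = a ^ p * f t ∧ f (b * t) = b ^ p * f t := by
    have hsign : (∀ x, 0 < x → x < u → 0 < f x) ∨ (∀ x, 0 < x → x < u → 0 < (-f) x) := by
      by_contra! hcon
      obtain ⟨⟨x, hx0, hxu, hx⟩, y, hy0, hyu, hy⟩ := hcon
      have hy' : 0 ≤ f y := by simpa using hy
      have hpre : IsPreconnected (Set.Ioo 0 u) := isPreconnected_Ioo
      obtain ⟨z, hz, hz0⟩ := hpre.intermediate_value ⟨hx0, hxu⟩ ⟨hy0, hyu⟩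
        (hc.mono fun z hz => hz.1.le) ⟨hx, hy'⟩
      exact hne z hz.1 hz.2 hz0
    rcases hsign with hs | hs
    · exact scaling_of_pos_near_zero ha hb hc h0 hu hs heq
    · obtain ⟨ha1, hb1, p, hp, h⟩ := scaling_of_pos_near_zero (f := -f) ha hb hc.neg
        (by simp [h0]) hu hs (fun t ht => by simp only [Pi.neg_apply]; rw [heq t ht]; ring)
      refine ⟨ha1, hb1, p, hp, fun t ht => ?_⟩
      simpa using h t ht
  obtain ⟨ha1, hb1, p, hp, h⟩ := hscale
  have hHc : ContinuousOn (fun t => f t / t ^ p) (Set.Ioi 0) := by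
    refine (hc.mono Set.Ioi_subset_Ici_self).div ?_ fun t ht => (Real.rpow_pos_of_pos ht p).ne'
    exact continuousOn_id.rpow_const fun t ht => Or.inl (ne_of_gt ht)
  have hinv : ∀ c, 0 < c → ∀ t, 0 < t → f (c * t) = c ^ p * f t →
      f t / t ^ p = f (c * t) / (c * t) ^ p := by
    intro c hc t ht e
    have := (Real.rpow_pos_of_pos hc p).ne'
    rw [e, Real.mul_rpow hc.le ht.le, mul_div_mul_left _ _ this]
  have hHa : ∀ t, 0 < t → f t / t ^ p = f (a * t) / (a * t) ^ p := fun t ht =>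
    hinv a ha t ht (h t ht).2.1
  have hHb : ∀ t, 0 < t → f t / t ^ p = f (b * t) / (b * t) ^ p := fun t ht =>
    hinv b hb t ht (h t ht).2.2
  refine ⟨ha1, hb1, p, hp, fun t => f t / t ^ p, hHc, fun t ht => ?_,
    fun t ht => ⟨hHa t ht, hHb t ht⟩, fun t ht => ?_, fun hirr s t hs ht => ?_⟩
  · exact div_ne_zero (h t ht).1 (Real.rpow_pos_of_pos ht p).ne'
  · rw [mul_div_cancel₀ _ (Real.rpow_pos_of_pos ht p).ne']
  · have hKc : Continuous fun x => f (Real.exp x) / Real.exp x ^ p :=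
      hHc.comp_continuous Real.continuous_exp fun x => Real.exp_pos x
    have hmul : ∀ c, 0 < c → ∀ x, Real.exp (x + Real.log c) = c * Real.exp x := by
      intro c hc x
      rw [Real.exp_add, Real.exp_log hc, mul_comm]
    have := eq_of_dense_periods hKc hirr
      (fun x => by simp only [hmul a ha]; exact (hHa _ (Real.exp_pos x)).symm)
      (fun x => by simp only [hmul b hb]; exact (hHb _ (Real.exp_pos x)).symm)
      (Real.log s) (Real.log t)
    simpa only [Real.exp_log hs, Real.exp_log ht] using this
end

section
/- Let a, b ∈ (0,∞). If the functional equation f(t) = f(at) + f(bt) (for all t ≥ 0) has a solution f belonging to the class 𝓕, then a ∈ (0,1) and b ∈ (0,1). -/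
/-- If `f` is positive near `0` and `1 ≤ a`, the equation makes `f (a⁻¹ ^ n * s)` bounded below by
`f s > 0`, contradicting continuity at `0`. -/
theorem lt_one_of_functionalEq_of_pos {a b u : ℝ} (hb : 0 < b) {f : ℝ → ℝ}
    (hf : ContinuousOn f (Set.Ici 0)) (hf0 : f 0 = 0) (hu : 0 < u)
    (hpos : ∀ x, 0 < x → x < u → 0 < f x)
    (heq : ∀ t : ℝ, 0 ≤ t → f t = f (a * t) + f (b * t)) : a < 1 := by
  by_contra! ha
  obtain ⟨s, hs0, hsu, hbs⟩ : ∃ s, 0 < s ∧ s < u ∧ b * s < u := by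
    refine ⟨u / (1 + b) / 2, by positivity, ?_, ?_⟩
    · rw [div_div, div_lt_iff₀ (by positivity)]
      nlinarith [mul_pos hu hb]
    · rw [div_div, ← mul_div_assoc, div_lt_iff₀ (by positivity)]
      nlinarith [mul_pos hu hb]
  rcases ha.eq_or_lt with rfl | ha1
  · have h := heq s hs0.le
    rw [one_mul] at h
    linarith [hpos (b * s) (by positivity) hbs]
  have ha0 : 0 < a := by linarith
  have hq0 : 0 < a⁻¹ := inv_pos.2 ha0
  have hq1 : a⁻¹ < 1 := inv_lt_one_of_one_lt₀ ha1
  have hge : ∀ n : ℕ, f s ≤ f (a⁻¹ ^ n * s) := by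
    intro n
    induction n with
    | zero => simp
    | succ n ih =>
      have h := heq (a⁻¹ ^ (n + 1) * s) (by positivity)
      have hshift : a * (a⁻¹ ^ (n + 1) * s) = a⁻¹ ^ n * s := by
        rw [pow_succ]
        field_simp
      rw [hshift] at h
      have hle : a⁻¹ ^ (n + 1) ≤ 1 := pow_le_one₀ hq0.le hq1.le
      have := hpos (b * (a⁻¹ ^ (n + 1) * s)) (by positivity)
        (by nlinarith [mul_le_mul_of_nonneg_left hle (mul_pos hb hs0).le])
      linarith
  have hlim : Filter.Tendsto (fun n : ℕ => a⁻¹ ^ n * s) Filter.atTop (nhdsWithin 0 (Set.Ici 0)) := by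
    refine tendsto_nhdsWithin_iff.2 ⟨?_, Filter.Eventually.of_forall fun n => ?_⟩
    · simpa using (tendsto_pow_atTop_nhds_zero_of_lt_one hq0.le hq1).mul_const s
    · exact Set.mem_Ici.2 (by positivity)
  have hle := ge_of_tendsto' ((hf 0 Set.self_mem_Ici).tendsto.comp hlim) hge
  linarith [hpos s hs0 hsu]

theorem lt_one_of_memClassF_of_functionalEq {a b : ℝ} (hb : 0 < b) {f : ℝ → ℝ}
    (hf : MemClassF f) (heq : ∀ t : ℝ, 0 ≤ t → f t = f (a * t) + f (b * t)) : a < 1 := by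
  obtain ⟨hc, hf0, u, hu, hne⟩ := hf
  have hsign : (∀ x ∈ Set.Ioo 0 u, 0 < f x) ∨ (∀ x ∈ Set.Ioo 0 u, f x < 0) := by
    by_contra! h
    obtain ⟨⟨x, hx, hfx⟩, y, hy, hfy⟩ := h
    obtain ⟨z, hz, hfz⟩ := isPreconnected_Ioo.intermediate_value hx hy
      (hc.mono fun w hw => hw.1.le) ⟨hfx, hfy⟩
    exact hne z hz.1 hz.2 hfz
  rcases hsign with h | h
  · exact lt_one_of_functionalEq_of_pos hb hc hf0 hu (fun x h0 h1 => h x ⟨h0, h1⟩) heq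
  · refine lt_one_of_functionalEq_of_pos (f := fun x => -f x) hb hc.neg (by simp [hf0]) hu
      (fun x h0 h1 => neg_pos.2 (h x ⟨h0, h1⟩)) fun t ht => ?_
    linarith [heq t ht]

theorem stmt_2 (a b : ℝ) (ha : 0 < a) (hb : 0 < b)
    (h : ∃ f : ℝ → ℝ, MemClassF f ∧ ∀ t : ℝ, 0 ≤ t → f t = f (a * t) + f (b * t)) :
    a < 1 ∧ b < 1 := by
  obtain ⟨f, hf, heq⟩ := h
  exact ⟨lt_one_of_memClassF_of_functionalEq hb hf heq,
    lt_one_of_memClassF_of_functionalEq ha hf fun t ht => (heq t ht).trans (add_comm _ _)⟩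
end

section
/- Let i, j ∈ ℤ. For every α > 0 and every β ∈ (0, 2α) there exists a natural number n₀ ≥ max{|i|, |j|} such that for every n ≥ 2n₀ and every k with n₀ ≤ k ≤ n − n₀ one has C(n+i+j, k+i) + α² · C(n−i−j, k−i) ≥ β · C(n,k). (Here all arguments of the binomial coefficients are nonnegative integers, since n₀ ≥ max{|i|,|j|} and n₀ ≤ k ≤ n − n₀.) -/
open Filter Topology in
theorem tendsto_factorial_add_mul_factorial_sub_div_sq (d : ℕ) :
    Tendsto (fun m : ℕ => ((m + d).factorial * (m - d).factorial : ℝ) / (m.factorial : ℝ) ^ 2)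
      atTop (𝓝 1) := by
  induction d with
  | zero =>
    refine tendsto_const_nhds.congr fun m => ?_
    have : (m.factorial : ℝ) ≠ 0 := by positivity
    simp only [add_zero, Nat.sub_zero]
    field_simp
  | succ d ih =>
    have hinv : Tendsto (fun m : ℕ => 1 + (2 * d + 1 : ℝ) / ((m : ℝ) - d)) atTop (𝓝 1) := by
      have h : Tendsto (fun m : ℕ => (m : ℝ) - d) atTop atTop :=
        tendsto_atTop_add_const_right _ (-(d : ℝ)) tendsto_natCast_atTop_atTop
      simpa using (h.const_div_atTop (2 * d + 1 : ℝ)).const_add 1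
    have hmul := ih.mul hinv
    rw [one_mul] at hmul
    refine hmul.congr' ?_
    filter_upwards [eventually_ge_atTop (d + 1)] with m hm
    obtain ⟨e, rfl⟩ := Nat.exists_eq_add_of_le hm
    have h1 : d + 1 + e - d = e + 1 := by omega
    have h2 : d + 1 + e - (d + 1) = e := by omega
    have h3 : d + 1 + e + (d + 1) = (d + 1 + e + d) + 1 := by omega
    have h4 : ((d + 1 + e : ℕ) : ℝ) - d = e + 1 := by push_cast; ring
    rw [h1, h2, h3, h4, Nat.factorial_succ e, Nat.factorial_succ (d + 1 + e + d)]
    have : ((d + 1 + e).factorial : ℝ) ≠ 0 := by positivity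
    have : (e : ℝ) + 1 ≠ 0 := by positivity
    push_cast
    field_simp
    ring

theorem factorial_sq_le_factorial_add_mul_factorial_sub {m d : ℕ} (h : d ≤ m) :
    m.factorial ^ 2 ≤ (m + d).factorial * (m - d).factorial := by
  obtain ⟨e, rfl⟩ := Nat.exists_eq_add_of_le h
  have h1 : d + e - d = e := by omega
  have hasc := Nat.factorial_mul_pow_le_factorial (n := d) (m := d + e)
  have hdesc : (d + e).factorial ≤ e.factorial * (d + e + 1) ^ d := by
    have := Nat.factorial_mul_ascFactorial e d
    rw [add_comm d e, ← this]
    refine Nat.mul_le_mul_left _ ((Nat.ascFactorial_le_pow_add e d).trans ?_)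
    exact Nat.pow_le_pow_left (by omega) d
  rw [h1, sq]
  calc (d + e).factorial * (d + e).factorial
      ≤ (d + e).factorial * (e.factorial * (d + e + 1) ^ d) := Nat.mul_le_mul_left _ hdesc
    _ = (d + e).factorial * (d + e + 1) ^ d * e.factorial := by ring
    _ ≤ (d + e + d).factorial * e.factorial := Nat.mul_le_mul_right _ hasc

theorem factorial_toNat_add_mul_factorial_toNat_sub (m : ℕ) (s : ℤ) :
    ((m : ℤ) + s).toNat.factorial * ((m : ℤ) - s).toNat.factorial
      = (m + s.natAbs).factorial * (m - s.natAbs).factorial := by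
  rcases le_total 0 s with h | h
  · rw [show ((m : ℤ) + s).toNat = m + s.natAbs by omega,
      show ((m : ℤ) - s).toNat = m - s.natAbs by omega]
  · rw [show ((m : ℤ) + s).toNat = m - s.natAbs by omega,
      show ((m : ℤ) - s).toNat = m + s.natAbs by omega, mul_comm]

theorem exists_mul_factorial_add_mul_factorial_sub_le {q : ℝ} (hq0 : 0 < q) (hq : q < 1) (d : ℕ) :
    ∃ N : ℕ, ∀ m ≥ N,
      q * ((m + d).factorial * (m - d).factorial : ℝ) ≤ (m.factorial : ℝ) ^ 2 := by
  have h := (tendsto_factorial_add_mul_factorial_sub_div_sq d).eventually_lt_const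
    ((one_lt_inv₀ hq0).2 hq)
  obtain ⟨N, hN⟩ := Filter.eventually_atTop.1 h
  refine ⟨N, fun m hm => ?_⟩
  have hm' := hN m hm
  have hpos : 0 < (m.factorial : ℝ) ^ 2 := by positivity
  rw [div_lt_iff₀ hpos, ← div_eq_inv_mul, lt_div_iff₀ hq0] at hm'
  linarith

theorem stmt_4 (i j : ℤ) (α β : ℝ) (hα : 0 < α) (hβ0 : 0 < β) (hβ : β < 2 * α) :
    ∃ n₀ : ℕ, max i.natAbs j.natAbs ≤ n₀ ∧
      ∀ n k : ℕ, 2 * n₀ ≤ n → n₀ ≤ k → k ≤ n - n₀ →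
        ((((n : ℤ) + i + j).toNat.choose ((k : ℤ) + i).toNat : ℝ)
            + α ^ 2 * (((n : ℤ) - i - j).toNat.choose ((k : ℤ) - i).toNat : ℝ))
          ≥ β * (n.choose k : ℝ) := by
  obtain ⟨q, hq⟩ : ∃ q, q = β / (2 * α) := ⟨_, rfl⟩
  have hq0 : 0 < q := by rw [hq]; positivity
  have hq1 : q < 1 := by rw [hq, div_lt_one (by positivity)]; exact hβ
  have hβq : β = 2 * α * q := by rw [hq]; field_simp
  obtain ⟨N₁, hN₁⟩ := exists_mul_factorial_add_mul_factorial_sub_le hq0 hq1 i.natAbs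
  obtain ⟨N₂, hN₂⟩ := exists_mul_factorial_add_mul_factorial_sub_le hq0 hq1 j.natAbs
  refine ⟨max (max i.natAbs j.natAbs) (max N₁ N₂), le_max_left _ _, fun n k hn hk hkn => ?_⟩
  obtain ⟨b, rfl⟩ : ∃ b, n = k + b := Nat.exists_eq_add_of_le (by omega)
  have hA := hN₁ k (by omega)
  have hB := hN₂ b (by omega)
  have hS : (k + b).factorial ^ 2 ≤ _ :=
    factorial_sq_le_factorial_add_mul_factorial_sub (d := (i + j).natAbs) (by omega)
  rw [← factorial_toNat_add_mul_factorial_toNat_sub] at hS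
  have hA' := factorial_toNat_add_mul_factorial_toNat_sub k i
  have hB' := factorial_toNat_add_mul_factorial_toNat_sub b j
  norm_cast at hA hB
  rw [← hA'] at hA
  rw [← hB'] at hB
  have e1 : (((k + b : ℕ) : ℤ) + (i + j)).toNat = ((k : ℤ) + i).toNat + ((b : ℤ) + j).toNat := by
    omega
  have e2 : (((k + b : ℕ) : ℤ) - (i + j)).toNat = ((k : ℤ) - i).toNat + ((b : ℤ) - j).toNat := by
    omega
  rw [add_assoc, sub_sub, e1, e2, Nat.choose_symm_add, Nat.choose_symm_add, Nat.choose_symm_add]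
  rw [e1, e2, ← Nat.add_choose_mul_factorial_mul_factorial k b,
    ← Nat.add_choose_mul_factorial_mul_factorial ((k : ℤ) + i).toNat,
    ← Nat.add_choose_mul_factorial_mul_factorial ((k : ℤ) - i).toNat] at hS
  generalize (((k : ℤ) + i).toNat + ((b : ℤ) + j).toNat).choose ((b : ℤ) + j).toNat = X at *
  generalize (((k : ℤ) - i).toNat + ((b : ℤ) - j).toNat).choose ((b : ℤ) - j).toNat = Y at *
  generalize (k + b).choose b = F at *
  have hS' := Nat.cast_le (α := ℝ).2 hS
  push_cast at hA hB hS'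
  have pA1 : (0 : ℝ) < ((k : ℤ) + i).toNat.factorial := by positivity
  have pA2 : (0 : ℝ) < ((k : ℤ) - i).toNat.factorial := by positivity
  have pB1 : (0 : ℝ) < ((b : ℤ) + j).toNat.factorial := by positivity
  have pB2 : (0 : ℝ) < ((b : ℤ) - j).toNat.factorial := by positivity
  generalize (((k : ℤ) + i).toNat.factorial : ℝ) = a₁ at *
  generalize (((k : ℤ) - i).toNat.factorial : ℝ) = a₂ at *
  generalize (((b : ℤ) + j).toNat.factorial : ℝ) = b₁ at *
  generalize (((b : ℤ) - j).toNat.factorial : ℝ) = b₂ at *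
  have hXY : (q * F) ^ 2 ≤ (X : ℝ) * Y := by
    refine le_of_mul_le_mul_right ?_ (show 0 < a₁ * a₂ * (b₁ * b₂) by positivity)
    calc (q * F) ^ 2 * (a₁ * a₂ * (b₁ * b₂))
        = (F : ℝ) ^ 2 * ((q * (a₁ * a₂)) * (q * (b₁ * b₂))) := by ring
      _ ≤ (F : ℝ) ^ 2 * ((k.factorial : ℝ) ^ 2 * (b.factorial : ℝ) ^ 2) := by gcongr
      _ = ((F : ℝ) * k.factorial * b.factorial) ^ 2 := by ring
      _ ≤ _ := hS'
      _ = (X : ℝ) * Y * (a₁ * a₂ * (b₁ * b₂)) := by ring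
  refine le_of_sq_le_sq ?_ (by positivity)
  rw [hβq]
  nlinarith [sq_nonneg ((X : ℝ) - α ^ 2 * Y), mul_le_mul_of_nonneg_left hXY (sq_nonneg α)]
end

section
/- Let φ : ℝ → ℝ be a nontrivial real-valued characteristic function of a probability measure on ℝ, and let a, b ∈ (0,∞) be such that φ(t) = φ(at)·φ(bt) for every t ∈ ℝ. Then a < 1 and b < 1, and φ(t) ≠ 0 for every t ∈ ℝ. -/
open MeasureTheory

/-- The characteristic function of a measure `μ` on `ℝ`. -/
noncomputable def charFunOf (μ : Measure ℝ) (t : ℝ) : ℂ :=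
  ∫ x, Complex.exp (t * x * Complex.I) ∂μ

open Filter Topology

theorem charFunOf_eq_charFun (μ : Measure ℝ) (t : ℝ) : charFunOf μ t = charFun μ t := by
  rw [charFun_apply_real, charFunOf]

theorem continuous_of_eq_charFunOf {φ : ℝ → ℝ} {μ : Measure ℝ} [IsProbabilityMeasure μ]
    (hφ : ∀ t : ℝ, (φ t : ℂ) = charFunOf μ t) : Continuous φ := by
  have h : φ = fun t => (charFun μ t).re := by
    funext t
    rw [← charFunOf_eq_charFun, ← hφ, Complex.ofReal_re]
  rw [h]
  exact Complex.continuous_re.comp continuous_charFun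

theorem eq_integral_cos_of_eq_charFunOf {φ : ℝ → ℝ} {μ : Measure ℝ} [IsProbabilityMeasure μ]
    (hφ : ∀ t : ℝ, (φ t : ℂ) = charFunOf μ t) (t : ℝ) : φ t = ∫ x, Real.cos (t * x) ∂μ := by
  have hint : Integrable (fun x : ℝ => Complex.exp (t * x * Complex.I)) μ := by
    refine Integrable.of_bound (C := 1) (by fun_prop) (ae_of_all _ fun x => ?_)
    rw [← Complex.ofReal_mul, Complex.norm_exp_ofReal_mul_I]
  rw [← Complex.ofReal_re (φ t), hφ, charFunOf]
  refine (integral_re hint).symm.trans (integral_congr_ae (ae_of_all _ fun x => ?_))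
  change (Complex.exp (t * x * Complex.I)).re = _
  rw [← Complex.ofReal_mul, Complex.exp_ofReal_mul_I_re]

theorem one_sub_two_mul_le_of_eq_charFunOf {φ : ℝ → ℝ} {μ : Measure ℝ} [IsProbabilityMeasure μ]
    (hφ : ∀ t : ℝ, (φ t : ℂ) = charFunOf μ t) (t : ℝ) : 1 - φ (2 * t) ≤ 4 * (1 - φ t) := by
  have hint (s : ℝ) : Integrable (fun x : ℝ => Real.cos (s * x)) μ :=
    Integrable.of_bound (C := 1) (by fun_prop) (ae_of_all _ fun x => Real.abs_cos_le_one _)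
  have hsub (s : ℝ) : 1 - φ s = ∫ x, (1 - Real.cos (s * x)) ∂μ := by
    rw [integral_sub (integrable_const _) (hint s), eq_integral_cos_of_eq_charFunOf hφ s]
    simp
  rw [hsub, hsub, ← integral_const_mul]
  refine integral_mono ((integrable_const _).sub (hint _))
    (((integrable_const _).sub (hint _)).const_mul _) fun x => ?_
  change 1 - Real.cos (2 * t * x) ≤ 4 * (1 - Real.cos (t * x))
  rw [mul_assoc, Real.cos_two_mul]
  nlinarith [sq_nonneg (Real.cos (t * x) - 1)]

/-- The sequence `r ^ n * t` eventually enters any neighbourhood of `0` when `0 ≤ r < 1`. -/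
theorem exists_pow_mul_of_eventually {p : ℝ → Prop} (h : ∀ᶠ t in 𝓝 0, p t) {r : ℝ} (hr0 : 0 ≤ r)
    (hr1 : r < 1) (t : ℝ) : ∃ n : ℕ, p (r ^ n * t) := by
  have ht : Tendsto (fun n : ℕ => r ^ n * t) atTop (𝓝 0) := by
    simpa using (tendsto_pow_atTop_nhds_zero_of_lt_one hr0 hr1).mul_const t
  exact (ht.eventually h).exists

theorem eq_one_of_eventually_eq_one {φ : ℝ → ℝ} {μ : Measure ℝ} [IsProbabilityMeasure μ]
    (hφ : ∀ t : ℝ, (φ t : ℂ) = charFunOf μ t) (hle : ∀ t, |φ t| ≤ 1)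
    (h : ∀ᶠ t in 𝓝 0, φ t = 1) (t : ℝ) : φ t = 1 := by
  obtain ⟨n, hn⟩ := exists_pow_mul_of_eventually h (r := 1 / 2) (by norm_num) (by norm_num) t
  induction n with
  | zero => simpa using hn
  | succ n ih =>
    apply ih
    have h2 := one_sub_two_mul_le_of_eq_charFunOf hφ ((1 / 2) ^ (n + 1) * t)
    have h3 : 2 * ((1 / 2 : ℝ) ^ (n + 1) * t) = (1 / 2) ^ n * t := by ring
    rw [hn, h3] at h2
    linarith [(abs_le.mp (hle ((1 / 2) ^ n * t))).2]

theorem lt_one_of_eq_mul {φ : ℝ → ℝ} {μ : Measure ℝ} [IsProbabilityMeasure μ]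
    (hφ : ∀ t : ℝ, (φ t : ℂ) = charFunOf μ t) (hle : ∀ t, |φ t| ≤ 1) (h0 : φ 0 = 1)
    (hφnt : ∃ t : ℝ, φ t ≠ 1) {a b : ℝ} (hb : 0 < b)
    (heq : ∀ t : ℝ, φ t = φ (a * t) * φ (b * t)) : a < 1 := by
  by_contra! ha
  obtain ⟨t₀, ht₀⟩ := hφnt
  refine ht₀ (eq_one_of_eventually_eq_one hφ hle ?_ t₀)
  have hc := continuous_of_eq_charFunOf hφ
  have hpos : ∀ᶠ t in 𝓝 0, 0 < φ t :=
    hc.continuousAt.eventually (lt_mem_nhds (by rw [h0]; exact one_pos))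
  rcases ha.eq_or_lt with rfl | ha
  · have hdiv : Tendsto (fun t : ℝ => t / b) (𝓝 0) (𝓝 0) := by
      simpa using (tendsto_id (x := 𝓝 (0 : ℝ))).div_const b
    filter_upwards [hdiv.eventually hpos] with t ht
    have h := heq (t / b)
    rw [one_mul, mul_div_cancel₀ _ hb.ne'] at h
    exact (mul_left_cancel₀ ht.ne' (by rw [← h, mul_one])).symm
  · have ha0 : 0 < a := one_pos.trans ha
    have hstep (t : ℝ) : |φ t| ≤ |φ (a * t)| := by
      rw [heq t, abs_mul]
      exact mul_le_of_le_one_right (abs_nonneg _) (hle _)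
    have hiter (t : ℝ) (n : ℕ) : |φ (a⁻¹ ^ n * t)| ≤ |φ t| := by
      induction n with
      | zero => simp
      | succ n ih =>
        refine (hstep _).trans ?_
        rwa [pow_succ', ← mul_assoc, ← mul_assoc, mul_inv_cancel₀ ha0.ne', one_mul]
    have hone (t : ℝ) : 1 ≤ |φ t| := by
      have hlim : Tendsto (fun n : ℕ => a⁻¹ ^ n * t) atTop (𝓝 0) := by
        simpa using (tendsto_pow_atTop_nhds_zero_of_lt_one (inv_nonneg.mpr ha0.le)
          (inv_lt_one_of_one_lt₀ ha)).mul_const t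
      have := (hc.abs.tendsto 0).comp hlim
      rw [h0, abs_one] at this
      exact le_of_tendsto this (Eventually.of_forall (hiter t))
    filter_upwards [hpos] with t ht
    rw [← abs_of_pos ht]
    exact le_antisymm (hle t) (hone t)

theorem ne_zero_of_eq_mul {φ : ℝ → ℝ} (hc : Continuous φ) (h0 : φ 0 ≠ 0) {a b : ℝ}
    (ha : 0 < a) (hb : 0 < b) (ha1 : a < 1) (hb1 : b < 1)
    (heq : ∀ t : ℝ, φ t = φ (a * t) * φ (b * t)) (t : ℝ) : φ t ≠ 0 := by
  intro ht
  have hzero (n : ℕ) : ∃ s, |s| ≤ max a b ^ n * |t| ∧ φ s = 0 := by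
    induction n with
    | zero => exact ⟨t, by simp, ht⟩
    | succ n ih =>
      obtain ⟨s, hs, hs0⟩ := ih
      have hscale {c : ℝ} (hc0 : 0 < c) (hcm : c ≤ max a b) :
          |c * s| ≤ max a b ^ (n + 1) * |t| := by
        rw [abs_mul, abs_of_pos hc0, pow_succ', mul_assoc]
        exact mul_le_mul hcm hs (abs_nonneg _) (hc0.le.trans hcm)
      rw [heq s] at hs0
      rcases mul_eq_zero.mp hs0 with h | h
      · exact ⟨a * s, hscale ha (le_max_left a b), h⟩
      · exact ⟨b * s, hscale hb (le_max_right a b), h⟩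
  obtain ⟨δ, hδ, hball⟩ := Metric.eventually_nhds_iff.mp (hc.continuousAt.eventually_ne h0)
  obtain ⟨n, hn⟩ := exists_pow_mul_of_eventually (gt_mem_nhds hδ)
    (ha.le.trans (le_max_left a b)) (max_lt ha1 hb1) |t|
  obtain ⟨s, hs, hs0⟩ := hzero n
  exact hball (by simpa using hs.trans_lt hn) hs0

theorem stmt_10 (φ : ℝ → ℝ) (μ : Measure ℝ) (hμ : IsProbabilityMeasure μ)
    (hφ : ∀ t : ℝ, (φ t : ℂ) = charFunOf μ t)
    (hφnt : ∃ t : ℝ, φ t ≠ 1)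
    (a b : ℝ) (ha : 0 < a) (hb : 0 < b)
    (heq : ∀ t : ℝ, φ t = φ (a * t) * φ (b * t)) :
    a < 1 ∧ b < 1 ∧ ∀ t : ℝ, φ t ≠ 0 := by
  have h0 : φ 0 = 1 := by simp [eq_integral_cos_of_eq_charFunOf hφ]
  have hle (t : ℝ) : |φ t| ≤ 1 := by
    have h := norm_charFun_le_one (μ := μ) t
    rwa [← charFunOf_eq_charFun, ← hφ, Complex.norm_real] at h
  have ha1 : a < 1 := lt_one_of_eq_mul hφ hle h0 hφnt hb heq
  have hb1 : b < 1 :=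
    lt_one_of_eq_mul hφ hle h0 hφnt ha fun t => (heq t).trans (mul_comm _ _)
  exact ⟨ha1, hb1, ne_zero_of_eq_mul (continuous_of_eq_charFunOf hφ) (by simp [h0]) ha hb ha1 hb1 heq⟩
end

section
/- Let p ∈ (0,2], q > 0 and C, D > 0, and define φ_{C,D,q,p}(t) = exp(−C|t|^q − D|t|^p) and ψ(t) = exp(−|t|^p) for t ∈ ℝ. Suppose there exist functions c, d : [0,∞)² → [0,∞) such that φ_{C,D,q,p}(rt)·φ_{C,D,q,p}(st) = φ_{C,D,q,p}(c(r,s)·t)·ψ(d(r,s)·t) for all r, s ≥ 0 and all t ∈ ℝ, and suppose there exists a probability measure λ on [0,∞) such that φ_{C,D,q,p}(t) = ∫_{[0,∞)} ψ(ts) λ(ds) for all t ∈ ℝ. Then q ≥ p. -/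
open MeasureTheory

theorem stmt_13 (p q C D : ℝ) (hp0 : 0 < p) (hp2 : p ≤ 2) (hq : 0 < q)
    (hC : 0 < C) (hD : 0 < D)
    (φ : ℝ → ℝ) (hφdef : ∀ t : ℝ, φ t = Real.exp (-(C * |t| ^ q) - D * |t| ^ p))
    (ψ : ℝ → ℝ) (hψdef : ∀ t : ℝ, ψ t = Real.exp (-|t| ^ p))
    (c d : ℝ → ℝ → ℝ)
    (hc : ∀ r s : ℝ, 0 ≤ r → 0 ≤ s → 0 ≤ c r s)
    (hd : ∀ r s : ℝ, 0 ≤ r → 0 ≤ s → 0 ≤ d r s)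
    (heq : ∀ r s t : ℝ, 0 ≤ r → 0 ≤ s →
      φ (r * t) * φ (s * t) = φ (c r s * t) * ψ (d r s * t))
    (lam : Measure ℝ) (hlam : IsProbabilityMeasure lam)
    (hsupp : lam (Set.Iio 0) = 0)
    (hmix : ∀ t : ℝ, φ t = ∫ s, ψ (t * s) ∂lam) :
    q ≥ p := by
  by_contra! hlt
  set a := c 1 1
  set b := d 1 1
  have ha : 0 ≤ a := hc 1 1 zero_le_one zero_le_one
  have hb : 0 ≤ b := hd 1 1 zero_le_one zero_le_one
  have key : ∀ t : ℝ, 0 ≤ t →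
      C * (2 - a ^ q) * t ^ q + (2 * D - D * a ^ p - b ^ p) * t ^ p = 0 := by
    intro t ht
    have h := heq 1 1 t zero_le_one zero_le_one
    rw [hφdef, hφdef, hψdef, ← Real.exp_add, ← Real.exp_add, Real.exp_eq_exp, one_mul,
      abs_of_nonneg ht, abs_of_nonneg (mul_nonneg ha ht), abs_of_nonneg (mul_nonneg hb ht),
      Real.mul_rpow ha ht, Real.mul_rpow ha ht, Real.mul_rpow hb ht] at h
    linarith
  have h1 := key 1 zero_le_one
  have h2 := key 2 zero_le_two
  rw [Real.one_rpow, Real.one_rpow] at h1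
  have h2lt : (2 : ℝ) ^ q < 2 ^ p := Real.rpow_lt_rpow_of_exponent_lt one_lt_two hlt
  have hprod : C * (2 - a ^ q) * ((2 : ℝ) ^ q - 2 ^ p) = 0 := by
    linear_combination h2 - (2 : ℝ) ^ p * h1
  have hzero : C * (2 - a ^ q) = 0 :=
    (mul_eq_zero.mp hprod).resolve_right (sub_ne_zero.mpr h2lt.ne)
  have haq : 2 - a ^ q = 0 := (mul_eq_zero.mp hzero).resolve_left hC.ne'
  have ha1 : 1 < a := by
    by_contra! hle
    linarith [Real.rpow_le_one ha hle hq.le]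
  have hap : a ^ q < a ^ p := Real.rpow_lt_rpow_of_exponent_lt ha1 hlt
  have hbp : 0 ≤ b ^ p := Real.rpow_nonneg hb p
  have hDap : D * 2 < D * a ^ p := mul_lt_mul_of_pos_left (by linarith) hD
  linarith
end

section
/- Let C, D > 0 and let α be a real number with 2k−1 < α < 2k for some positive integer k. Then the function g : (0,∞) → ℝ defined by g(t) = exp(−C t^{α} − D t) is not completely monotone on (0,∞); that is, it is not the case that (−1)^n · g^{(n)}(t) ≥ 0 for all n ∈ ℕ and all t > 0. Consequently, there is no probability measure λ on [0,∞) such that g(t) = ∫_{[0,∞)} e^{−ts} λ(ds) for all t > 0. -/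
open MeasureTheory

/-- Finite sums of real powers `c * t ^ β` on `(0, ∞)` in which every exponent is either `0` or
strictly greater than `γ`. -/
inductive IsPowerSumAbove (γ : ℝ) : (ℝ → ℝ) → Prop
  | monomial (r : ℝ → ℝ) (c β : ℝ) (hβ : β = 0 ∨ γ < β) (h : ∀ t : ℝ, 0 < t → r t = c * t ^ β) :
      IsPowerSumAbove γ r
  | add (r r₁ r₂ : ℝ → ℝ) (h₁ : IsPowerSumAbove γ r₁) (h₂ : IsPowerSumAbove γ r₂)
      (h : ∀ t : ℝ, 0 < t → r t = r₁ t + r₂ t) : IsPowerSumAbove γ r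

namespace IsPowerSumAbove

lemma mono {γ γ' : ℝ} (hγ : γ' ≤ γ) {r : ℝ → ℝ} (h : IsPowerSumAbove γ r) :
    IsPowerSumAbove γ' r := by
  induction h with
  | monomial r c β hβ h => exact .monomial r c β (hβ.imp_right hγ.trans_lt) h
  | add r r₁ r₂ _ _ h ih₁ ih₂ => exact .add r r₁ r₂ ih₁ ih₂ h

lemma const_mul_rpow_mul {γ γ' δ : ℝ} (hδ : δ = 0 ∨ γ' < δ) (hγ : γ' ≤ γ + δ) (d : ℝ)
    {r : ℝ → ℝ} (h : IsPowerSumAbove γ r) :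
    IsPowerSumAbove γ' (fun t => d * t ^ δ * r t) := by
  induction h with
  | monomial r c β hβ h =>
    refine .monomial _ (d * c) (δ + β) ?_ fun t ht => ?_
    · rcases hβ with rfl | hβ
      · simpa using hδ
      · exact .inr (by linarith)
    · rw [h t ht, Real.rpow_add ht]
      ring
  | add r r₁ r₂ _ _ h ih₁ ih₂ =>
    exact .add _ _ _ ih₁ ih₂ fun t ht => by rw [h t ht]; ring

lemma exists_hasDerivAt {γ : ℝ} {r : ℝ → ℝ} (h : IsPowerSumAbove γ r) :
    ∃ r', IsPowerSumAbove (γ - 1) r' ∧ ∀ t : ℝ, 0 < t → HasDerivAt r (r' t) t := by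
  induction h with
  | monomial r c β hβ h =>
    refine ⟨fun t => c * (β * t ^ (β - 1)), ?_, fun t ht => ?_⟩
    · rcases hβ with rfl | hβ
      · exact .monomial _ 0 0 (.inl rfl) fun t _ => by simp
      · exact .monomial _ (c * β) (β - 1) (.inr (by linarith)) fun t _ => by ring
    · refine ((Real.hasDerivAt_rpow_const (.inl ht.ne')).const_mul c).congr_of_eventuallyEq ?_
      filter_upwards [Ioi_mem_nhds ht] with x hx using h x hx
  | add r r₁ r₂ _ _ h ih₁ ih₂ =>
    obtain ⟨r₁', h₁, hd₁⟩ := ih₁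
    obtain ⟨r₂', h₂, hd₂⟩ := ih₂
    refine ⟨fun t => r₁' t + r₂' t, .add _ _ _ h₁ h₂ fun _ _ => rfl, fun t ht => ?_⟩
    refine ((hd₁ t ht).add (hd₂ t ht)).congr_of_eventuallyEq ?_
    filter_upwards [Ioi_mem_nhds ht] with x hx using h x hx

lemma tendsto_mul_rpow_neg {γ : ℝ} (hγ : γ < 0) {r : ℝ → ℝ} (h : IsPowerSumAbove γ r) :
    Filter.Tendsto (fun t => r t * t ^ (-γ)) (nhdsWithin 0 (Set.Ioi 0)) (nhds 0) := by
  induction h with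
  | monomial r c β hβ h =>
    have hpos : 0 < β - γ := by rcases hβ with rfl | hβ <;> linarith
    have hlim : Filter.Tendsto (fun t : ℝ => c * t ^ (β - γ)) (nhdsWithin 0 (Set.Ioi 0))
        (nhds 0) := by
      have := ((Real.continuousAt_rpow_const 0 _ (.inr hpos.le)).tendsto.const_mul c).mono_left
        (nhdsWithin_le_nhds (s := Set.Ioi 0))
      simpa [Real.zero_rpow hpos.ne'] using this
    refine hlim.congr' ?_
    filter_upwards [self_mem_nhdsWithin] with t ht
    rw [h t ht, sub_eq_add_neg, Real.rpow_add ht]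
    ring
  | add r r₁ r₂ _ _ h ih₁ ih₂ =>
    have hlim := ih₁.add ih₂
    rw [add_zero] at hlim
    refine hlim.congr' ?_
    filter_upwards [self_mem_nhdsWithin] with t ht
    rw [h t ht]
    ring

end IsPowerSumAbove

lemma hasDerivAt_exp_neg_rpow_sub_linear (C D α : ℝ) {t : ℝ} (ht : 0 < t) :
    HasDerivAt (fun t : ℝ => Real.exp (-(C * t ^ α) - D * t))
      (Real.exp (-(C * t ^ α) - D * t) * (-(C * (α * t ^ (α - 1))) - D)) t := by
  have h₁ := ((Real.hasDerivAt_rpow_const (p := α) (.inl ht.ne')).const_mul C).neg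
  have h₂ := (hasDerivAt_id t).const_mul D
  simpa using (h₁.sub h₂).exp

lemma exists_iteratedDeriv_exp_neg_rpow_sub_linear (C D : ℝ) {α : ℝ} (hα : 0 < α) (n : ℕ) :
    ∃ r, IsPowerSumAbove (α - (n + 1)) r ∧ ∀ t : ℝ, 0 < t →
      iteratedDeriv (n + 1) (fun t : ℝ => Real.exp (-(C * t ^ α) - D * t)) t =
        Real.exp (-(C * t ^ α) - D * t) *
          (-(C * (∏ i ∈ Finset.range (n + 1), (α - i)) * t ^ (α - (n + 1))) + r t) := by
  induction n with
  | zero =>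
    refine ⟨fun _ => -D, .monomial _ (-D) 0 (.inl rfl) fun t _ => by simp, fun t ht => ?_⟩
    rw [zero_add, iteratedDeriv_one, (hasDerivAt_exp_neg_rpow_sub_linear C D α ht).deriv]
    simp
    ring
  | succ n ih =>
    obtain ⟨r, hr, hd⟩ := ih
    obtain ⟨r', hr', hd'⟩ := hr.exists_hasDerivAt
    set P := ∏ i ∈ Finset.range (n + 1), (α - (i : ℝ)) with hP
    have hn : (0 : ℝ) ≤ n := n.cast_nonneg
    have hq : IsPowerSumAbove (α - (n + 1) - 1)
        (fun t => -(C * α) * t ^ (α - 1) * r t + -D * t ^ (0 : ℝ) * r t) :=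
      .add _ _ _ (hr.const_mul_rpow_mul (.inr (by linarith)) (by linarith) _)
        (hr.const_mul_rpow_mul (.inl rfl) (by linarith) _) fun _ _ => rfl
    have hm : IsPowerSumAbove (α - (n + 1) - 1)
        (fun t => C * α * (C * P) * t ^ (α - 1 + (α - (n + 1))) +
          D * (C * P) * t ^ (α - (n + 1))) :=
      .add _ _ _ (.monomial _ _ _ (.inr (by linarith)) fun _ _ => rfl)
        (.monomial _ _ _ (.inr (by linarith)) fun _ _ => rfl) fun _ _ => rfl
    refine ⟨fun t => r' t + ((-(C * α) * t ^ (α - 1) * r t + -D * t ^ (0 : ℝ) * r t) +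
      (C * α * (C * P) * t ^ (α - 1 + (α - (n + 1))) + D * (C * P) * t ^ (α - (n + 1)))),
      ?_, fun t ht => ?_⟩
    · push_cast
      rw [← sub_sub]
      exact .add _ _ _ hr' (.add _ _ _ hq hm fun _ _ => rfl) fun _ _ => rfl
    · have hev : iteratedDeriv (n + 1) (fun t : ℝ => Real.exp (-(C * t ^ α) - D * t)) =ᶠ[nhds t]
          fun t => Real.exp (-(C * t ^ α) - D * t) *
            (-(C * P * t ^ (α - (n + 1))) + r t) := by
        filter_upwards [Ioi_mem_nhds ht] with x hx using hd x hx
      have hlead := ((Real.hasDerivAt_rpow_const (p := α - (n + 1)) (.inl ht.ne')).const_mul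
        (C * P)).neg
      have hprod := (hasDerivAt_exp_neg_rpow_sub_linear C D α ht).fun_mul
        (hlead.add (hd' t ht))
      rw [iteratedDeriv_succ, hev.deriv_eq]
      refine hprod.deriv.trans ?_
      simp only [Pi.add_apply, Pi.neg_apply]
      rw [Finset.prod_range_succ, ← hP, Real.rpow_add ht, Real.rpow_zero]
      push_cast
      rw [← sub_sub α ((n : ℝ) + 1) 1]
      ring

lemma exists_iteratedDeriv_exp_neg_rpow_sub_linear_neg {C : ℝ} (hC : 0 < C) (D : ℝ) {α : ℝ}
    {n : ℕ} (hα₀ : 0 < α) (hα₁ : n < α) (hα₂ : α < n + 1) :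
    ∃ t : ℝ, 0 < t ∧
      iteratedDeriv (n + 1) (fun t : ℝ => Real.exp (-(C * t ^ α) - D * t)) t < 0 := by
  obtain ⟨r, hr, hd⟩ := exists_iteratedDeriv_exp_neg_rpow_sub_linear C D hα₀ n
  have hP : 0 < ∏ i ∈ Finset.range (n + 1), (α - (i : ℝ)) := by
    refine Finset.prod_pos fun i hi => sub_pos.2 (lt_of_le_of_lt ?_ hα₁)
    exact_mod_cast Finset.mem_range_succ_iff.1 hi
  have hlt := (hr.tendsto_mul_rpow_neg (by linarith)).eventually_lt_const (mul_pos hC hP)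
  obtain ⟨t, hrt, ht⟩ := (hlt.and self_mem_nhdsWithin).exists
  have ht : 0 < t := ht
  refine ⟨t, ht, ?_⟩
  rw [hd t ht]
  refine mul_neg_of_pos_of_neg (Real.exp_pos _) ?_
  rw [Real.rpow_neg ht.le, ← div_eq_mul_inv, div_lt_iff₀ (Real.rpow_pos_of_pos ht _)] at hrt
  linarith

/-- The Laplace transform of a finite measure on `[0, ∞)` is completely monotone. -/
lemma neg_one_pow_mul_iteratedDeriv_nonneg_of_eq_laplace {lam : Measure ℝ} [IsFiniteMeasure lam]
    (hlam : lam (Set.Iio 0) = 0) {g : ℝ → ℝ}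
    (hg : ∀ t : ℝ, 0 < t → g t = ∫ s, Real.exp (-(t * s)) ∂lam) (n : ℕ) {t : ℝ} (ht : 0 < t) :
    0 ≤ (-1 : ℝ) ^ n * iteratedDeriv n g t := by
  have hnonneg : ∀ᵐ s ∂lam, 0 ≤ s := by
    simp only [ae_iff, not_le]
    exact hlam
  have hsub : Set.Ioi 0 ⊆ ProbabilityTheory.integrableExpSet (fun s : ℝ => -s) lam := by
    intro u hu
    refine Integrable.of_bound (C := 1) (by fun_prop) ?_
    filter_upwards [hnonneg] with s hs
    rw [Real.norm_eq_abs, Real.abs_exp, Real.exp_le_one_iff]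
    nlinarith [Set.mem_Ioi.1 hu]
  have hmem : t ∈ interior (ProbabilityTheory.integrableExpSet (fun s : ℝ => -s) lam) :=
    interior_maximal hsub isOpen_Ioi ht
  have hev : g =ᶠ[nhds t] ProbabilityTheory.mgf (fun s : ℝ => -s) lam := by
    filter_upwards [Ioi_mem_nhds ht] with u hu
    rw [hg u hu, ProbabilityTheory.mgf]
    simp only [mul_neg]
  rw [hev.iteratedDeriv_eq, ProbabilityTheory.iteratedDeriv_mgf hmem, ← integral_const_mul]
  refine integral_nonneg_of_ae ?_
  filter_upwards [hnonneg] with s hs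
  rw [← mul_assoc, ← mul_pow, neg_one_mul, neg_neg]
  positivity

theorem stmt_14 (C D α : ℝ) (hC : 0 < C) (hD : 0 < D) (k : ℕ) (hk : 0 < k)
    (hα1 : (2 * k - 1 : ℝ) < α) (hα2 : α < 2 * k)
    (g : ℝ → ℝ) (hg : ∀ t : ℝ, g t = Real.exp (-(C * t ^ α) - D * t)) :
    (¬ ∀ n : ℕ, ∀ t : ℝ, 0 < t → 0 ≤ (-1 : ℝ) ^ n * iteratedDeriv n g t) ∧
    ¬ ∃ lam : Measure ℝ, IsProbabilityMeasure lam ∧ lam (Set.Iio 0) = 0 ∧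
      ∀ t : ℝ, 0 < t → g t = ∫ s, Real.exp (-(t * s)) ∂lam := by
  have hnot : ¬ ∀ n : ℕ, ∀ t : ℝ, 0 < t → 0 ≤ (-1 : ℝ) ^ n * iteratedDeriv n g t := by
    intro h
    obtain ⟨m, rfl⟩ : ∃ m, k = m + 1 := ⟨k - 1, by omega⟩
    push_cast at hα1 hα2
    have hm : (0 : ℝ) ≤ m := m.cast_nonneg
    obtain ⟨t, ht, hneg⟩ := exists_iteratedDeriv_exp_neg_rpow_sub_linear_neg hC D
      (α := α) (n := 2 * m + 1) (by linarith) (by push_cast; linarith) (by push_cast; linarith)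
    have hsign := h (2 * m + 1 + 1) t ht
    rw [Even.neg_one_pow ⟨m + 1, by ring⟩, one_mul, funext hg] at hsign
    exact hsign.not_gt hneg
  refine ⟨hnot, ?_⟩
  rintro ⟨lam, hprob, hlam, hlap⟩
  exact hnot fun n t ht => neg_one_pow_mul_iteratedDeriv_nonneg_of_eq_laplace hlam hlap n ht
end

section
/- Let n be a positive integer. For every r > 0, ∫₀^∞ f_{2,n}(r/√s) · s^{−1/2} · f_{1/2}(s) ds = (2^{2−n} Γ(n) / (Γ(n/2))²) · r^{n−1} / (r² + 1)^{(n+1)/2}, where f_{2,n}(u) = (2 / (2^{n/2} Γ(n/2))) u^{n−1} e^{−u²/2} for u > 0 and f_{1/2}(s) = (2π)^{−1/2} s^{−3/2} e^{−1/(2s)} for s > 0. In other words, the density f_{1,n} of the ω_n-weakly strictly Cauchy distribution equals f_{1,n}(r) = (2^{2−n} Γ(n) / Γ(n/2)²) · r^{n−1} (r²+1)^{−(n+1)/2} for r > 0. -/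
open MeasureTheory Real

/-- The normalising integral of the inverse gamma distribution. -/
theorem integral_rpow_neg_mul_exp_neg_div_Ioi {a b : ℝ} (ha : 0 < a) (hb : 0 < b) :
    ∫ s in Set.Ioi (0 : ℝ), s ^ (-a - 1) * Real.exp (-(b / s)) = (1 / b) ^ a * Real.Gamma a := by
  rw [← Real.integral_rpow_mul_exp_neg_mul_Ioi ha hb,
    ← integral_comp_rpow_Ioi (fun t : ℝ => t ^ (a - 1) * Real.exp (-(b * t)))
      (neg_ne_zero.mpr one_ne_zero)]
  refine setIntegral_congr_fun measurableSet_Ioi fun s (hs : 0 < s) => ?_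
  simp only [abs_neg, abs_one, one_mul, smul_eq_mul]
  rw [← Real.rpow_mul hs.le, ← mul_assoc, ← Real.rpow_add hs, Real.rpow_neg_one, div_eq_mul_inv]
  ring_nf

theorem stmt_17 (n : ℕ) (hn : 0 < n)
    (f2n : ℝ → ℝ)
    (hf2n : ∀ u : ℝ, 0 < u →
      f2n u = 2 / (2 ^ ((n : ℝ) / 2) * Real.Gamma ((n : ℝ) / 2))
        * u ^ (n - 1) * Real.exp (-(u ^ 2) / 2))
    (fhalf : ℝ → ℝ)
    (hfhalf : ∀ s : ℝ, 0 < s →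
      fhalf s = (2 * π) ^ (-(1 : ℝ) / 2) * s ^ (-(3 : ℝ) / 2) * Real.exp (-(1 / (2 * s)))) :
    ∀ r : ℝ, 0 < r →
      ∫ s in Set.Ioi (0 : ℝ), f2n (r / Real.sqrt s) * (Real.sqrt s)⁻¹ * fhalf s
        = 2 ^ (2 - (n : ℝ)) * Real.Gamma n / (Real.Gamma ((n : ℝ) / 2)) ^ 2
          * r ^ (n - 1) / (r ^ 2 + 1) ^ (((n : ℝ) + 1) / 2) := by
  intro r hr
  have hn' : (0 : ℝ) < n := Nat.cast_pos.mpr hn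
  have integrand_eq : ∀ s ∈ Set.Ioi (0 : ℝ),
      f2n (r / Real.sqrt s) * (Real.sqrt s)⁻¹ * fhalf s
        = (2 / (2 ^ ((n : ℝ) / 2) * Real.Gamma ((n : ℝ) / 2)) * r ^ (n - 1)
            * (2 * π) ^ (-(1 : ℝ) / 2))
          * (s ^ (-(((n : ℝ) + 1) / 2) - 1) * Real.exp (-(((r ^ 2 + 1) / 2) / s))) := by
    intro s (hs : 0 < s)
    have power_eq : s ^ (-(((n : ℝ) + 1) / 2) - 1)
        = (Real.sqrt s ^ (n - 1))⁻¹ * (Real.sqrt s)⁻¹ * s ^ (-(3 : ℝ) / 2) := by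
      rw [← mul_inv, ← pow_succ, Nat.sub_add_cancel hn, Real.sqrt_eq_rpow, ← Real.rpow_natCast,
        ← Real.rpow_mul hs.le, ← Real.rpow_neg hs.le, ← Real.rpow_add hs]
      ring_nf
    have exp_eq : Real.exp (-(((r ^ 2 + 1) / 2) / s))
        = Real.exp (-((r / Real.sqrt s) ^ 2) / 2) * Real.exp (-(1 / (2 * s))) := by
      rw [← Real.exp_add, div_pow, Real.sq_sqrt hs.le]
      congr 1
      field_simp
      ring
    rw [hf2n _ (div_pos hr (Real.sqrt_pos.mpr hs)), hfhalf s hs, power_eq, exp_eq, div_pow]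
    ring
  rw [setIntegral_congr_fun measurableSet_Ioi integrand_eq, integral_const_mul,
    integral_rpow_neg_mul_exp_neg_div_Ioi (by positivity) (by positivity), one_div_div,
    Real.div_rpow two_pos.le (by positivity)]
  have duplication := Real.Gamma_mul_Gamma_add_half ((n : ℝ) / 2)
  rw [show (n : ℝ) / 2 + 1 / 2 = ((n : ℝ) + 1) / 2 by ring, mul_div_cancel₀ _ two_ne_zero]
    at duplication
  have hΓ : 0 < Real.Gamma ((n : ℝ) / 2) := Real.Gamma_pos_of_pos (by positivity)
  have two_pi_rpow : (2 * π) ^ (-(1 : ℝ) / 2) = (2 : ℝ) ^ (-(1 : ℝ) / 2) * (√π)⁻¹ := by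
    rw [Real.mul_rpow two_pos.le pi_pos.le, Real.sqrt_eq_rpow, ← Real.rpow_neg pi_pos.le]
    ring_nf
  have two_rpow : (2 : ℝ) ^ (((n : ℝ) + 1) / 2) * 2 ^ (-(1 : ℝ) / 2) = 2 ^ ((n : ℝ) / 2) := by
    rw [← Real.rpow_add two_pos]
    ring_nf
  have two_rpow_sub : (2 : ℝ) ^ (2 - (n : ℝ)) = 2 * 2 ^ (1 - (n : ℝ)) := by
    rw [show (2 : ℝ) - n = 1 + (1 - n) by ring, Real.rpow_add two_pos, Real.rpow_one]
  have hπ : 0 < √π := Real.sqrt_pos.mpr pi_pos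
  have hΓ' : Real.Gamma (((n : ℝ) + 1) / 2)
      = Real.Gamma n * 2 ^ (1 - (n : ℝ)) * √π / Real.Gamma ((n : ℝ) / 2) := by
    rw [eq_div_iff hΓ.ne', mul_comm, duplication]
  rw [hΓ', two_pi_rpow, two_rpow_sub, ← two_rpow]
  have h₁ : (0 : ℝ) < 2 ^ (((n : ℝ) + 1) / 2) := by positivity
  have h₂ : (0 : ℝ) < 2 ^ (-(1 : ℝ) / 2) := by positivity
  have h₃ : 0 < (r ^ 2 + 1) ^ (((n : ℝ) + 1) / 2) := by positivity
  generalize (2 : ℝ) ^ (((n : ℝ) + 1) / 2) = A at *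
  generalize (2 : ℝ) ^ (-(1 : ℝ) / 2) = B at *
  generalize (r ^ 2 + 1) ^ (((n : ℝ) + 1) / 2) = C at *
  field_simp
end
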